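/- Let E ⊂ ℝ² be a compact set with dim_H E > 1 that is not contained in a line. Then the angle set 𝒜(E) = {θ(x¹,x²,x³) : x¹,x²,x³ ∈ E distinct} has positive 1-dimensional Lebesgue measure, where θ(x¹,x²,x³) is the interior angle at x¹ of the triangle with vertices x¹, x², x³. -/

import Mathlib

open MeasureTheory

/-- The angle set of `A ⊆ ℝ²`: interior angles at `x₁` of triangles with distinct
vertices `x₁, x₂, x₃ ∈ A`. -/
def angleSet (A : Set (EuclideanSpace ℝ (Fin 2))) : Set ℝ :=
  {θ | ∃ x₁ ∈ A, ∃ x₂ ∈ A, ∃ x₃ ∈ A, x₁ ≠ x₂ ∧ x₁ ≠ x₃ ∧ x₂ ≠ x₃ ∧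
    θ = EuclideanGeometry.angle x₂ x₁ x₃}

open Set Filter Topology ENNReal

theorem exists_measure_refining_partition {X ι κ : Type*} [MeasurableSpace X] [Nonempty X]
    [Countable ι] [MeasurableSpace ι] [MeasurableSingletonClass ι]
    [MeasurableSpace κ] [MeasurableSingletonClass κ]
    (ν : OuterMeasure X) (hν : ν univ ≠ ∞) {f : X → ι} {g : X → κ}
    (hf : Measurable f) (hg : Measurable g) (hfin : (range g).Finite) {p : κ → ι}
    (hp : ∀ x, f x = p (g x)) (μ : Measure X) (hμ : ∀ b, μ (f ⁻¹' {b}) ≤ ν (f ⁻¹' {b})) :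
    ∃ μ' : Measure X, μ'.map f = μ.map f ∧ ∀ a, μ' (g ⁻¹' {a}) ≤ ν (g ⁻¹' {a}) := by
  classical
  set F := hfin.toFinset with hF
  set ρ : κ → X := Function.invFun g
  have hρ : ∀ a ∈ F, g (ρ a) = a := fun a ha =>
    Function.invFun_eq (f := g) (b := a) (by simpa [hF] using ha)
  set S : ι → ℝ≥0∞ := fun b => ∑ a ∈ F with p a = b, ν (g ⁻¹' {a}) with hS
  have hSfin : ∀ b, S b ≠ ∞ := fun b =>
    (ENNReal.sum_lt_top.2 fun a _ => (measure_mono (subset_univ _)).trans_lt hν.lt_top).ne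
  have hSle : ∀ b, ν (f ⁻¹' {b}) ≤ S b := fun b => by
    refine le_trans (measure_mono ?_) (measure_biUnion_finset_le _ _)
    intro x hx
    simp only [mem_iUnion, Finset.mem_filter]
    exact ⟨g x, ⟨by simp [hF], by rw [← hp]; exact hx⟩, rfl⟩
  set w : κ → ℝ≥0∞ := fun a => ν (g ⁻¹' {a}) * (μ (f ⁻¹' {p a}) / S (p a)) with hw
  have key : ∀ s : Set X, MeasurableSet s →
      (∑ a ∈ F, w a • Measure.dirac (ρ a)) s = ∑ a ∈ F, if ρ a ∈ s then w a else 0 := by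
    intro s hs
    simp only [Measure.coe_finsetSum, Finset.sum_apply, Measure.smul_apply,
      Measure.dirac_apply' _ hs, smul_eq_mul, indicator, Pi.one_apply, mul_ite, mul_one, mul_zero]
  refine ⟨∑ a ∈ F, w a • Measure.dirac (ρ a), ?_, fun a => ?_⟩
  · refine Measure.ext_iff_singleton.2 fun b => ?_
    have hb := hf (measurableSet_singleton b)
    rw [Measure.map_apply hf (measurableSet_singleton b),
      Measure.map_apply hf (measurableSet_singleton b), key _ hb]
    have : (∑ a ∈ F, if ρ a ∈ f ⁻¹' {b} then w a else 0)
        = ∑ a ∈ F with p a = b, ν (g ⁻¹' {a}) * (μ (f ⁻¹' {b}) / S b) := by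
      rw [Finset.sum_filter]
      refine Finset.sum_congr rfl fun a ha => ?_
      have : ρ a ∈ f ⁻¹' {b} ↔ p a = b := by simp [hp, hρ a ha]
      simp only [this]
      split_ifs with h
      · rw [← h]
      · rfl
    rw [this, ← Finset.sum_mul]
    change S b * _ = _
    by_cases h0 : S b = 0
    · have : μ (f ⁻¹' {b}) = 0 := le_antisymm ((hμ b).trans ((hSle b).trans h0.le)) bot_le
      simp [this]
    · exact ENNReal.mul_div_cancel h0 (hSfin b)
  · rw [key _ (hg (measurableSet_singleton a))]
    calc (∑ a' ∈ F, if ρ a' ∈ g ⁻¹' {a} then w a' else 0)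
        = ∑ a' ∈ F, if a = a' then w a' else 0 := by
          refine Finset.sum_congr rfl fun a' ha' => ?_
          simp [hρ a' ha', eq_comm]
      _ ≤ w a := by rw [Finset.sum_ite_eq]; split_ifs <;> simp
      _ ≤ ν (g ⁻¹' {a}) * 1 := by
          refine mul_le_mul_right ?_ _
          exact ENNReal.div_le_of_le_mul (by rw [one_mul]; exact (hμ _).trans (hSle _))
      _ = _ := mul_one _

/-- A finite outer measure dominates, on every cell of the first `n` levels of a nested sequence of
finite partitions, some measure with the same total mass. -/
theorem exists_measure_le_outerMeasure_on_partitions {X ι : Type*} [MeasurableSpace X] [Nonempty X]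
    [Countable ι] [MeasurableSpace ι] [MeasurableSingletonClass ι]
    (ν : OuterMeasure X) (hν : ν univ ≠ ∞) {π : ℕ → X → ι}
    (hπ : ∀ n, Measurable (π n)) (hfin : ∀ n, (range (π n)).Finite) {p : ι → ι}
    (hp : ∀ n x, π n x = p (π (n + 1) x)) (n : ℕ) :
    ∃ μ : Measure X, μ univ = ν univ ∧ ∀ k ≤ n, ∀ b, μ (π k ⁻¹' {b}) ≤ ν (π k ⁻¹' {b}) := by
  have hpm : Measurable p := measurable_of_countable p
  induction n with
  | zero =>
    obtain ⟨x⟩ := ‹Nonempty X›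
    obtain ⟨μ, h1, h2⟩ := exists_measure_refining_partition ν hν (f := fun _ => ())
      measurable_const (hπ 0) (hfin 0) (p := fun _ => ()) (fun _ => rfl)
      (ν univ • Measure.dirac x) (by simp)
    refine ⟨μ, ?_, ?_⟩
    · have := congrArg (fun m => m univ) h1
      simpa [Measure.map_apply measurable_const MeasurableSet.univ] using this
    · intro k hk b
      obtain rfl : k = 0 := by omega
      exact h2 b
  | succ n ih =>
    obtain ⟨μ, h1, h2⟩ := ih
    obtain ⟨μ', h3, h4⟩ := exists_measure_refining_partition ν hν (hπ n) (hπ (n + 1)) (hfin (n + 1))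
      (hp n) μ (h2 n le_rfl)
    have hmap : ∀ j ≤ n, μ'.map (π (n - j)) = μ.map (π (n - j)) := by
      intro j hj
      induction j with
      | zero => exact h3
      | succ j ih =>
        have e : π (n - (j + 1)) = p ∘ π (n - j) := by
          ext1 x
          rw [hp, show n - (j + 1) + 1 = n - j by omega]; rfl
        rw [e, ← Measure.map_map hpm (hπ _), ih (by omega), Measure.map_map hpm (hπ _)]
    refine ⟨μ', ?_, fun k hk b => ?_⟩
    · have := congrArg (fun m => m univ) h3
      simp only [Measure.map_apply (hπ n) MeasurableSet.univ, preimage_univ] at this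
      rw [this, h1]
    · rcases hk.lt_or_eq with hk | rfl
      · have := congrArg (fun m => m {b}) (hmap (n - k) (by omega))
        simp only [show n - (n - k) = k by omega,
          Measure.map_apply (hπ k) (measurableSet_singleton b)] at this
        rw [this]
        exact h2 k (by omega) b
      · exact h4 b

theorem exists_pre_hausdorff_ne_zero {X : Type*} [MetricSpace X] [MeasurableSpace X] [BorelSpace X]
    {s : ℝ} (h : μH[s] (univ : Set X) ≠ 0) :
    ∃ n : ℕ, OuterMeasure.mkMetric'.pre (fun t : Set X => Metric.ediam t ^ s) (n : ℝ≥0∞)⁻¹ univ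
      ≠ 0 := by
  by_contra! hc
  apply h
  rw [Measure.hausdorffMeasure, ← Measure.coe_toOuterMeasure, Measure.mkMetric_toOuterMeasure,
    OuterMeasure.mkMetric, OuterMeasure.mkMetric'.eq_iSup_nat, OuterMeasure.iSup_apply]
  simpa using hc

/-- A form of **Frostman's lemma** in a compact metric space carrying dyadic partitions. -/
theorem exists_frostman_measure_of_partitions {X ι : Type*} [MetricSpace X] [CompactSpace X]
    [MeasurableSpace X] [BorelSpace X]
    [Countable ι] [MeasurableSpace ι] [MeasurableSingletonClass ι] {π : ℕ → X → ι}
    (hπ : ∀ n, Measurable (π n)) (hfin : ∀ n, (range (π n)).Finite) {p : ι → ι}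
    (hp : ∀ n x, π n x = p (π (n + 1) x))
    (hdiam : ∀ n b, Metric.ediam (π n ⁻¹' {b}) ≤ 2 * 2⁻¹ ^ n)
    {N : ℕ} (hball : ∀ n x, ∃ T : Finset ι, T.card ≤ N ∧
      Metric.ball x (2⁻¹ ^ n) ⊆ ⋃ b ∈ T, π n ⁻¹' {b})
    {s : ℝ} (hs : 0 ≤ s) (hH : μH[s] (univ : Set X) ≠ 0) :
    ∃ (μ : ProbabilityMeasure X) (C : ℝ≥0∞), C ≠ ∞ ∧
      ∀ x n, (μ : Measure X) (Metric.ball x (2⁻¹ ^ n)) ≤ C * ((2⁻¹ : ℝ≥0∞) ^ s) ^ n := by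
  classical
  have hX : Nonempty X := by
    by_contra hX
    rw [not_nonempty_iff] at hX
    exact hH (by rw [univ_eq_empty_iff.2 hX, measure_empty])
  obtain ⟨m, hm⟩ := exists_pre_hausdorff_ne_zero hH
  set ν := OuterMeasure.mkMetric'.pre (fun t : Set X => Metric.ediam t ^ s) (m : ℝ≥0∞)⁻¹ with hνdef
  set q : ℝ≥0∞ := (2⁻¹ : ℝ≥0∞) ^ s with hq
  have hq0 : q ≠ 0 := by
    rw [hq, Ne, ENNReal.rpow_eq_zero_iff]
    simp
  have hqtop : q ≠ ∞ := ENNReal.rpow_ne_top_of_nonneg hs (by simp)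
  have hpow : ∀ n : ℕ, (2 * 2⁻¹ ^ n : ℝ≥0∞) ^ s = 2 ^ s * q ^ n := by
    intro n
    rw [ENNReal.mul_rpow_of_nonneg _ _ hs, hq, ← ENNReal.rpow_natCast, ← ENNReal.rpow_natCast,
      ← ENNReal.rpow_mul, ← ENNReal.rpow_mul, mul_comm s]
  obtain ⟨n₀, hn₀⟩ : ∃ n₀ : ℕ, ∀ n ≥ n₀, (2 * 2⁻¹ ^ n : ℝ≥0∞) ≤ (m : ℝ≥0∞)⁻¹ := by
    have : Tendsto (fun n : ℕ => (2 * 2⁻¹ ^ n : ℝ≥0∞)) atTop (𝓝 (2 * 0)) :=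
      ENNReal.Tendsto.const_mul (ENNReal.tendsto_pow_atTop_nhds_zero_of_lt_one (by simp))
        (Or.inr (by simp))
    rw [mul_zero] at this
    have h2 := this.eventually (gt_mem_nhds (show (0 : ℝ≥0∞) < (m : ℝ≥0∞)⁻¹ by simp))
    obtain ⟨n₀, h⟩ := eventually_atTop.1 h2
    exact ⟨n₀, fun n hn => (h n hn).le⟩
  have hcell : ∀ n ≥ n₀, ∀ b, ν (π n ⁻¹' {b}) ≤ 2 ^ s * q ^ n := by
    intro n hn b
    refine (OuterMeasure.mkMetric'.pre_le ((hdiam n b).trans (hn₀ n hn))).trans ?_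
    rw [← hpow]
    exact ENNReal.rpow_le_rpow (hdiam n b) hs
  have h2s : (2 : ℝ≥0∞) ^ s ≠ ∞ := ENNReal.rpow_ne_top_of_nonneg hs (by simp)
  have hνfin : ν univ ≠ ∞ := by
    have : (univ : Set X) ⊆ ⋃ b ∈ (hfin n₀).toFinset, π n₀ ⁻¹' {b} := fun x _ => by simp
    refine ((measure_mono this).trans (measure_biUnion_finset_le _ _)).trans_lt ?_ |>.ne
    refine ENNReal.sum_lt_top.2 fun b _ => (hcell n₀ le_rfl b).trans_lt ?_
    exact (ENNReal.mul_ne_top h2s (ENNReal.pow_ne_top hqtop)).lt_top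
  choose μ hμ1 hμ2 using exists_measure_le_outerMeasure_on_partitions ν hνfin hπ hfin hp
  have hinv : (ν univ)⁻¹ ≠ ∞ := ENNReal.inv_ne_top.2 hm
  let P : ℕ → ProbabilityMeasure X := fun n => ⟨(ν univ)⁻¹ • μ n,
    ⟨by rw [Measure.smul_apply, smul_eq_mul, hμ1, ENNReal.inv_mul_cancel hm hνfin]⟩⟩
  have hlim : Tendsto P (hyperfilter ℕ) (𝓝 (Ultrafilter.map P (hyperfilter ℕ)).lim) :=
    (Ultrafilter.map P (hyperfilter ℕ)).le_nhds_lim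
  refine ⟨(Ultrafilter.map P (hyperfilter ℕ)).lim, (ν univ)⁻¹ * (N * 2 ^ s) + (q ^ n₀)⁻¹,
    ?_, fun x n => ?_⟩
  · refine ENNReal.add_ne_top.2 ⟨ENNReal.mul_ne_top hinv (ENNReal.mul_ne_top (by simp) h2s), ?_⟩
    exact ENNReal.inv_ne_top.2 (pow_ne_zero _ hq0)
  rcases le_or_gt n₀ n with hn | hn
  · have hev : ∀ᶠ k in (hyperfilter ℕ : Filter ℕ), (P k : Measure X) (Metric.ball x (2⁻¹ ^ n))
        ≤ (ν univ)⁻¹ * (N * 2 ^ s) * q ^ n := by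
      have : ∀ᶠ k in atTop, n ≤ k := eventually_ge_atTop n
      rw [← Nat.cofinite_eq_atTop] at this
      filter_upwards [hyperfilter_le_cofinite this] with k hk
      obtain ⟨T, hT, hsub⟩ := hball n x
      calc (P k : Measure X) (Metric.ball x (2⁻¹ ^ n))
          = (ν univ)⁻¹ * μ k (Metric.ball x (2⁻¹ ^ n)) := rfl
        _ ≤ (ν univ)⁻¹ * ∑ b ∈ T, 2 ^ s * q ^ n := by
            refine mul_le_mul_right ?_ _
            refine (measure_mono hsub).trans ((measure_biUnion_finset_le _ _).trans ?_)
            exact Finset.sum_le_sum fun b _ => (hμ2 k n hk b).trans (hcell n hn b)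
        _ ≤ (ν univ)⁻¹ * (N * (2 ^ s * q ^ n)) := by
            rw [Finset.sum_const, nsmul_eq_mul]
            gcongr
        _ = _ := by ring
    calc _ ≤ _ := ProbabilityMeasure.le_liminf_measure_open_of_tendsto hlim Metric.isOpen_ball
      _ ≤ (ν univ)⁻¹ * (N * 2 ^ s) * q ^ n := liminf_le_of_frequently_le' hev.frequently
      _ ≤ _ := by rw [add_mul]; exact le_self_add
  · calc _ ≤ 1 := prob_le_one
      _ = (q ^ n₀)⁻¹ * q ^ n₀ :=
        (ENNReal.inv_mul_cancel (pow_ne_zero _ hq0) (ENNReal.pow_ne_top hqtop)).symm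
      _ ≤ (q ^ n₀)⁻¹ * q ^ n := by
        refine mul_le_mul_right (pow_le_pow_right_of_le_one' ?_ hn.le) _
        exact ENNReal.rpow_le_one (by simp) hs
      _ ≤ _ := by rw [add_mul]; exact le_add_self

theorem EuclideanSpace.abs_sub_coord_le_dist {ι : Type*} [Fintype ι] (x y : EuclideanSpace ℝ ι)
    (i : ι) : |x i - y i| ≤ dist x y := by
  rw [dist_eq_norm]
  exact PiLp.norm_apply_le (x - y) i

theorem EuclideanSpace.dist_le_abs_add_abs (x y : EuclideanSpace ℝ (Fin 2)) :
    dist x y ≤ |x 0 - y 0| + |x 1 - y 1| := by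
  rw [EuclideanSpace.dist_eq, Fin.sum_univ_two, Real.dist_eq, Real.dist_eq]
  refine Real.sqrt_le_iff.2 ⟨by positivity, ?_⟩
  nlinarith [abs_nonneg (x 0 - y 0), abs_nonneg (x 1 - y 1)]

/-- The index of the dyadic square of side `2⁻ⁿ` containing a point of the plane. -/
noncomputable def dyadicIndex (n : ℕ) (x : EuclideanSpace ℝ (Fin 2)) : ℤ × ℤ :=
  (⌊2 ^ n * x 0⌋, ⌊2 ^ n * x 1⌋)

theorem floor_two_pow_mul (n : ℕ) (y : ℝ) :
    ⌊(2 : ℝ) ^ n * y⌋ = ⌊(2 : ℝ) ^ (n + 1) * y⌋ / 2 := by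
  have h := Int.floor_div_natCast ((2 : ℝ) ^ (n + 1) * y) 2
  rw [← Nat.cast_ofNat (R := ℤ), ← h]
  congr 1
  push_cast
  ring

theorem exists_frostman_measure {E : Set (EuclideanSpace ℝ (Fin 2))} (hE : IsCompact E)
    {s : ℝ} (hs : 0 ≤ s) (hH : μH[s] E ≠ 0) :
    ∃ (μ : ProbabilityMeasure E) (C : ℝ≥0∞), C ≠ ∞ ∧
      ∀ x n, (μ : Measure E) (Metric.ball x (2⁻¹ ^ n)) ≤ C * ((2⁻¹ : ℝ≥0∞) ^ s) ^ n := by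
  have : CompactSpace E := isCompact_iff_compactSpace.1 hE
  have hH' : μH[s] (univ : Set E) ≠ 0 := by
    rw [← isometry_subtype_coe.hausdorffMeasure_image (Or.inl hs), image_univ, Subtype.range_coe]
    exact hH
  have hpos : ∀ n : ℕ, (0 : ℝ) < 2 ^ n := fun n => by positivity
  refine exists_frostman_measure_of_partitions (π := fun n (x : E) => dyadicIndex n x)
    (p := fun a => (a.1 / 2, a.2 / 2)) (N := 9) (fun n => ?_) (fun n => ?_) (fun n x => ?_)
    (fun n b => ?_) (fun n x => ?_) hs hH'
  · unfold dyadicIndex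
    fun_prop
  · obtain ⟨R, hR⟩ := hE.isBounded.exists_norm_le
    refine ((Set.finite_Icc ⌊-(2 ^ n * R)⌋ ⌊2 ^ n * R⌋).prod
      (Set.finite_Icc ⌊-(2 ^ n * R)⌋ ⌊2 ^ n * R⌋)).subset ?_
    rintro _ ⟨x, rfl⟩
    have h : ∀ i, |x.1 i| ≤ R := fun i => (PiLp.norm_apply_le x.1 i).trans (hR _ x.2)
    have h2 : ∀ i, -(2 ^ n * R) ≤ 2 ^ n * x.1 i ∧ 2 ^ n * x.1 i ≤ 2 ^ n * R := fun i => by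
      have := abs_le.1 (h i)
      constructor <;> nlinarith [hpos n]
    exact ⟨⟨Int.floor_mono (h2 0).1, Int.floor_mono (h2 0).2⟩,
      ⟨Int.floor_mono (h2 1).1, Int.floor_mono (h2 1).2⟩⟩
  · exact Prod.ext (floor_two_pow_mul n _) (floor_two_pow_mul n _)
  · refine Metric.ediam_le fun x hx y hy => ?_
    have hxy : dyadicIndex n x = dyadicIndex n y := hx.trans hy.symm
    have h : ∀ i, ⌊2 ^ n * x.1 i⌋ = ⌊2 ^ n * y.1 i⌋ → |x.1 i - y.1 i| ≤ 2⁻¹ ^ n := fun i hi => by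
      have := Int.abs_sub_lt_one_of_floor_eq_floor hi
      rw [← mul_sub, abs_mul, abs_of_pos (hpos n)] at this
      rw [inv_pow, ← one_div, le_div_iff₀ (hpos n), mul_comm]
      exact this.le
    have h2 := EuclideanSpace.dist_le_abs_add_abs x.1 y.1
    have h3 := h 0 (congrArg Prod.fst hxy)
    have h4 := h 1 (congrArg Prod.snd hxy)
    rw [edist_dist]
    calc ENNReal.ofReal (dist x y) ≤ ENNReal.ofReal (2 * 2⁻¹ ^ n) :=
          ENNReal.ofReal_le_ofReal (h2.trans (by linarith))
      _ = _ := by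
          rw [ENNReal.ofReal_mul (by norm_num), ENNReal.ofReal_pow (by norm_num),
            ENNReal.ofReal_inv_of_pos (by norm_num)]
          simp
  · refine ⟨Finset.Icc (⌊2 ^ n * x.1 0⌋ - 1) (⌊2 ^ n * x.1 0⌋ + 1) ×ˢ
      Finset.Icc (⌊2 ^ n * x.1 1⌋ - 1) (⌊2 ^ n * x.1 1⌋ + 1), ?_, fun y hy => ?_⟩
    · rw [Finset.card_product, Int.card_Icc, Int.card_Icc]
      have h : ∀ k : ℤ, k + 1 + 1 - (k - 1) = 3 := fun k => by ring
      rw [h, h]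
      decide
    have h : ∀ i, ⌊2 ^ n * y.1 i⌋ ∈ Finset.Icc (⌊2 ^ n * x.1 i⌋ - 1) (⌊2 ^ n * x.1 i⌋ + 1) := by
      intro i
      have h1 := (EuclideanSpace.abs_sub_coord_le_dist y.1 x.1 i).trans_lt hy
      rw [inv_pow, ← one_div, lt_div_iff₀ (hpos n), mul_comm, ← abs_of_pos (hpos n), ← abs_mul,
        mul_sub, abs_sub_lt_iff] at h1
      rw [Finset.mem_Icc]
      constructor
      · rw [← Int.floor_sub_one]
        exact Int.floor_mono (by linarith)
      · rw [← Int.floor_add_one]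
        exact Int.floor_mono (by linarith)
    simp only [mem_iUnion]
    exact ⟨_, Finset.mem_product.2 ⟨h 0, h 1⟩, rfl⟩

/-- The kernel estimate behind the energy bound for projections along lines of bounded slope. -/
theorem volume_setOf_abs_add_mul_le (w : EuclideanSpace ℝ (Fin 2)) {δ : ℝ} (hδ : 0 < δ) :
    (volume.restrict (Icc (-1 : ℝ) 1)) {t | |w 0 + t * w 1| ≤ δ}
      ≤ ENNReal.ofReal (8 * δ) * ‖w‖ₑ⁻¹ := by
  rcases eq_or_ne w 0 with rfl | hw
  · simp [ENNReal.mul_top, hδ]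
  have hd : 0 < ‖w‖ := norm_pos_iff.2 hw
  have hrhs : ENNReal.ofReal (8 * δ) * ‖w‖ₑ⁻¹ = ENNReal.ofReal (8 * δ / ‖w‖) := by
    rw [ENNReal.ofReal_div_of_pos hd, ofReal_norm, div_eq_mul_inv]
  rw [hrhs, Measure.restrict_apply' measurableSet_Icc]
  rcases lt_or_ge ‖w‖ (2 * δ) with h | h
  · refine (measure_mono inter_subset_right).trans ?_
    rw [Real.volume_Icc]
    refine ENNReal.ofReal_le_ofReal ?_
    rw [le_div_iff₀ hd]
    linarith
  · rcases ({t | |w 0 + t * w 1| ≤ δ} ∩ Icc (-1 : ℝ) 1).eq_empty_or_nonempty with h0 | ⟨t₀, ht₀, hI⟩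
    · simp [h0]
    have hw1 : ‖w‖ ≤ |w 0| + |w 1| := by
      simpa using EuclideanSpace.dist_le_abs_add_abs w 0
    have h1 : |w 0| ≤ δ + |w 1| := by
      have h2 : |t₀ * w 1| ≤ |w 1| := by
        rw [abs_mul]
        exact mul_le_of_le_one_left (abs_nonneg _) (abs_le.2 hI)
      have h3 := abs_sub (w 0 + t₀ * w 1) (t₀ * w 1)
      rw [add_sub_cancel_right] at h3
      have h4 : |w 0 + t₀ * w 1| ≤ δ := ht₀
      linarith
    have h2 : ‖w‖ / 4 ≤ |w 1| := by linarith
    have h3 : 0 < |w 1| := by linarith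
    have hsub : {t | |w 0 + t * w 1| ≤ δ} ∩ Icc (-1 : ℝ) 1
        ⊆ Metric.closedBall (-(w 0 / w 1)) (δ / |w 1|) := by
      rintro t ⟨ht, -⟩
      rw [Metric.mem_closedBall, Real.dist_eq, le_div_iff₀ h3, ← abs_mul]
      have : (t - -(w 0 / w 1)) * w 1 = w 0 + t * w 1 := by
        field_simp [abs_pos.1 h3]
        ring
      rw [this]
      exact ht
    refine (measure_mono hsub).trans ?_
    rw [Real.volume_closedBall]
    refine ENNReal.ofReal_le_ofReal ?_
    rw [← mul_div_assoc, div_le_div_iff₀ h3 hd]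
    nlinarith

/-- A measure with a Frostman condition of exponent larger than one has uniformly small local
Riesz potentials of order one. -/
theorem exists_setLIntegral_inv_edist_le {X : Type*} [MetricSpace X] [MeasurableSpace X]
    [BorelSpace X] {μ : Measure X} {C q : ℝ≥0∞} (hC : C ≠ ∞) (hq : 2 * q < 1)
    (hμ : ∀ x n, μ (Metric.ball x (2⁻¹ ^ n)) ≤ C * q ^ n) {η : ℝ≥0∞} (hη : 0 < η) :
    ∃ J : ℕ, ∀ x, ∫⁻ y in Metric.ball x (2⁻¹ ^ J), (edist x y)⁻¹ ∂μ ≤ η := by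
  have hA : 2 * C * (1 - 2 * q)⁻¹ ≠ ∞ :=
    ENNReal.mul_ne_top (ENNReal.mul_ne_top (by simp) hC)
      (ENNReal.inv_ne_top.2 (tsub_pos_of_lt hq).ne')
  obtain ⟨J, hJ⟩ : ∃ J : ℕ, 2 * C * (1 - 2 * q)⁻¹ * (2 * q) ^ J < η := by
    have : Tendsto (fun n : ℕ => 2 * C * (1 - 2 * q)⁻¹ * (2 * q) ^ n) atTop
        (𝓝 (2 * C * (1 - 2 * q)⁻¹ * 0)) :=
      ENNReal.Tendsto.const_mul (ENNReal.tendsto_pow_atTop_nhds_zero_of_lt_one hq) (Or.inr hA)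
    rw [mul_zero] at this
    exact (this.eventually (gt_mem_nhds hη)).exists
  refine ⟨J, fun x => le_trans ?_ hJ.le⟩
  have hpt : ∀ y ∈ Metric.ball x ((2⁻¹ : ℝ) ^ J), (edist x y)⁻¹ ≤
      ∑' j : ℕ, (Metric.ball x ((2⁻¹ : ℝ) ^ (J + j))).indicator
        (fun _ => (2 : ℝ≥0∞) ^ (J + j + 1)) y := by
    intro y hy
    rcases eq_or_ne y x with rfl | hyx
    · have h1 : ∀ j : ℕ, (1 : ℝ≥0∞) ≤ (Metric.ball y ((2⁻¹ : ℝ) ^ (J + j))).indicator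
          (fun _ => (2 : ℝ≥0∞) ^ (J + j + 1)) y := fun j => by
        rw [indicator_of_mem (Metric.mem_ball_self (by positivity))]
        exact one_le_pow_of_one_le' one_le_two _
      refine le_trans le_top (le_trans ?_ (ENNReal.tsum_le_tsum h1))
      rw [ENNReal.tsum_const_eq_top_of_ne_zero one_ne_zero]
    · have hd : 0 < dist x y := dist_pos.2 hyx.symm
      rw [Metric.mem_ball, dist_comm] at hy
      obtain ⟨j, hj1, hj2⟩ : ∃ j : ℕ, (2⁻¹ : ℝ) ^ (J + j + 1) ≤ dist x y
          ∧ dist x y < 2⁻¹ ^ (J + j) := by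
        have hex : ∃ n : ℕ, (2⁻¹ : ℝ) ^ (J + n + 1) ≤ dist x y := by
          obtain ⟨n, hn⟩ := exists_pow_lt_of_lt_one hd (show (2⁻¹ : ℝ) < 1 by norm_num)
          exact ⟨n, (pow_le_pow_of_le_one (by norm_num) (by norm_num) (by omega)).trans hn.le⟩
        classical
        refine ⟨Nat.find hex, Nat.find_spec hex, ?_⟩
        rcases h : Nat.find hex with _ | m
        · simpa using hy
        · have := Nat.find_min hex (m := m) (by omega)
          rw [not_le] at this
          simpa [add_assoc] using this
      refine le_trans ?_ (ENNReal.le_tsum j)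
      rw [indicator_of_mem (by rwa [Metric.mem_ball, dist_comm]), ENNReal.inv_le_iff_inv_le,
        ENNReal.inv_pow, edist_dist]
      calc (2⁻¹ : ℝ≥0∞) ^ (J + j + 1) = ENNReal.ofReal (2⁻¹ ^ (J + j + 1)) := by
            rw [ENNReal.ofReal_pow (by norm_num), ENNReal.ofReal_inv_of_pos (by norm_num)]
            simp
        _ ≤ _ := ENNReal.ofReal_le_ofReal hj1
  calc ∫⁻ y in Metric.ball x (2⁻¹ ^ J), (edist x y)⁻¹ ∂μ
      ≤ ∫⁻ y in Metric.ball x (2⁻¹ ^ J), ∑' j : ℕ,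
          (Metric.ball x ((2⁻¹ : ℝ) ^ (J + j))).indicator
            (fun _ => (2 : ℝ≥0∞) ^ (J + j + 1)) y ∂μ :=
        setLIntegral_mono' Metric.isOpen_ball.measurableSet hpt
    _ ≤ ∫⁻ y, ∑' j : ℕ, (Metric.ball x ((2⁻¹ : ℝ) ^ (J + j))).indicator
            (fun _ => (2 : ℝ≥0∞) ^ (J + j + 1)) y ∂μ := setLIntegral_le_lintegral _ _
    _ = ∑' j : ℕ, (2 : ℝ≥0∞) ^ (J + j + 1) * μ (Metric.ball x ((2⁻¹ : ℝ) ^ (J + j))) := by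
        rw [lintegral_tsum fun j =>
          (measurable_const.indicator Metric.isOpen_ball.measurableSet).aemeasurable]
        congr with j
        rw [lintegral_indicator_const Metric.isOpen_ball.measurableSet]
    _ ≤ ∑' j : ℕ, 2 * C * (2 * q) ^ J * (2 * q) ^ j := by
        refine ENNReal.tsum_le_tsum fun j => (mul_le_mul_right (hμ x (J + j)) _).trans_eq ?_
        ring
    _ = 2 * C * (1 - 2 * q)⁻¹ * (2 * q) ^ J := by
        rw [ENNReal.tsum_mul_left, ENNReal.tsum_geometric]
        ring

/-- A pigeonhole bound: many pairs of points have close images under a bounded function. -/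
theorem sq_measure_le_prod_setOf_abs_sub_le {X : Type*} [MeasurableSpace X] {μ : Measure X}
    [SFinite μ] {f : X → ℝ} (hf : Measurable f) {R : ℕ} (hR : ∀ x, |f x| < R)
    {G : Set X} (hG : MeasurableSet G) (n : ℕ) :
    μ G ^ 2 ≤ (2 * R * 2 ^ n) *
      (μ.prod μ) {p | p.1 ∈ G ∧ p.2 ∈ G ∧ |f p.1 - f p.2| ≤ 2⁻¹ ^ n} := by
  have hpos : (0 : ℝ) < 2 ^ n := by positivity
  set c : X → ℤ := fun x => ⌊2 ^ n * f x⌋ with hc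
  have hcm : Measurable c := by fun_prop
  set T : Finset ℤ := Finset.Ico (-((R : ℤ) * 2 ^ n)) (R * 2 ^ n) with hT
  have hcard : (T.card : ℝ≥0∞) = 2 * R * 2 ^ n := by
    have : T.card = 2 * R * 2 ^ n := by
      rw [hT, Int.card_Ico, sub_neg_eq_add, ← two_mul, ← mul_assoc]
      exact_mod_cast Int.toNat_natCast _
    rw [this]
    push_cast
    rfl
  set S : ℤ → Set X := fun k => G ∩ c ⁻¹' {k} with hS
  have hSm : ∀ k, MeasurableSet (S k) := fun k => hG.inter (hcm (measurableSet_singleton k))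
  have hcov : G ⊆ ⋃ k ∈ T, S k := by
    intro x hx
    simp only [mem_iUnion]
    refine ⟨c x, ?_, hx, rfl⟩
    obtain ⟨h1, h2⟩ := abs_lt.1 (hR x)
    rw [hT, Finset.mem_Ico]
    constructor
    · rw [Int.le_floor]
      push_cast
      nlinarith
    · rw [Int.floor_lt]
      push_cast
      nlinarith
  have hdisj : (T : Set ℤ).PairwiseDisjoint fun k => S k ×ˢ S k := by
    intro k _ l _ hkl
    refine Set.disjoint_left.2 fun p hp hp' => hkl ?_
    exact hp.1.2.symm.trans hp'.1.2
  calc μ G ^ 2 ≤ (∑ k ∈ T, μ (S k)) ^ 2 := by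
        gcongr
        exact (measure_mono hcov).trans (measure_biUnion_finset_le _ _)
    _ ≤ T.card * ∑ k ∈ T, μ (S k) ^ 2 := by
        have := ENNReal.rpow_sum_le_const_mul_sum_rpow T (fun k => μ (S k)) one_le_two
        norm_num at this
        exact this
    _ = T.card * (μ.prod μ) (⋃ k ∈ T, S k ×ˢ S k) := by
        rw [measure_biUnion_finset hdisj fun k _ => (hSm k).prod (hSm k)]
        simp only [Measure.prod_prod, sq]
    _ ≤ _ := by
        rw [hcard]
        refine mul_le_mul_right (measure_mono ?_) _
        intro p hp
        simp only [mem_iUnion] at hp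
        obtain ⟨k, -, hp1, hp2⟩ := hp
        refine ⟨hp1.1, hp2.1, ?_⟩
        have := Int.abs_sub_lt_one_of_floor_eq_floor (hp1.2.trans hp2.2.symm)
        rw [← mul_sub, abs_mul, abs_of_pos hpos] at this
        rw [inv_pow, ← one_div, le_div_iff₀ hpos, mul_comm]
        exact this.le

/-- The slope parameter `t` of a vector `v` orthogonal to `(1, t)` is determined, up to the
orientation `σ = ±1`, by the angle from a fixed vector `w`. -/
theorem slope_eq_of_angle {w v : EuclideanSpace ℝ (Fin 2)} (hw : w ≠ 0) {t : ℝ}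
    (hv : v ≠ 0) (h : v 0 + t * v 1 = 0) :
    ∃ σ ∈ ({1, -1} : Set ℝ),
      Real.cos (InnerProductGeometry.angle w v) * w 1
        + σ * Real.sin (InnerProductGeometry.angle w v) * w 0 ≠ 0 ∧
      t = -(Real.cos (InnerProductGeometry.angle w v) * w 0
        - σ * Real.sin (InnerProductGeometry.angle w v) * w 1) /
        (Real.cos (InnerProductGeometry.angle w v) * w 1
        + σ * Real.sin (InnerProductGeometry.angle w v) * w 0) := by
  have hwn : 0 < ‖w‖ := norm_pos_iff.2 hw
  have hvn : 0 < ‖v‖ := norm_pos_iff.2 hv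
  have hin := InnerProductGeometry.cos_angle_mul_norm_mul_norm w v
  set α := InnerProductGeometry.angle w v
  have hw2 : ‖w‖ ^ 2 = w 0 ^ 2 + w 1 ^ 2 := by
    rw [EuclideanSpace.real_norm_sq_eq, Fin.sum_univ_two]
  have hv2 : ‖v‖ ^ 2 = v 0 ^ 2 + v 1 ^ 2 := by
    rw [EuclideanSpace.real_norm_sq_eq, Fin.sum_univ_two]
  have hinner : inner ℝ w v = w 0 * v 0 + w 1 * v 1 := by
    simp [PiLp.inner_apply, Fin.sum_univ_two, mul_comm]
  rw [hinner] at hin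
  have hv1 : v 1 ≠ 0 := by
    intro h1
    rw [h1, mul_zero, add_zero] at h
    rw [h, h1] at hv2
    nlinarith
  have hsin : (Real.sin α * (‖w‖ * ‖v‖)) ^ 2 = (w 0 * v 1 - w 1 * v 0) ^ 2 := by
    have e : (Real.cos α * (‖w‖ * ‖v‖)) ^ 2 + (Real.sin α * (‖w‖ * ‖v‖)) ^ 2
        = ‖w‖ ^ 2 * ‖v‖ ^ 2 := by
      linear_combination (‖w‖ ^ 2 * ‖v‖ ^ 2) * Real.sin_sq_add_cos_sq α
    rw [hin, hw2, hv2] at e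
    linear_combination e
  obtain ⟨σ, hσ, hs⟩ : ∃ σ ∈ ({1, -1} : Set ℝ),
      σ * Real.sin α * (‖w‖ * ‖v‖) = w 0 * v 1 - w 1 * v 0 := by
    rcases sq_eq_sq_iff_eq_or_eq_neg.1 hsin with h | h
    · exact ⟨1, by simp, by rw [one_mul, h]⟩
    · exact ⟨-1, by simp, by linear_combination -h⟩
  have h0 : (Real.cos α * w 0 - σ * Real.sin α * w 1) * (‖w‖ * ‖v‖) = ‖w‖ ^ 2 * v 0 := by
    rw [hw2]
    linear_combination w 0 * hin - w 1 * hs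
  have h1 : (Real.cos α * w 1 + σ * Real.sin α * w 0) * (‖w‖ * ‖v‖) = ‖w‖ ^ 2 * v 1 := by
    rw [hw2]
    linear_combination w 1 * hin + w 0 * hs
  have hD : Real.cos α * w 1 + σ * Real.sin α * w 0 ≠ 0 := by
    intro hD
    rw [hD, zero_mul] at h1
    exact mul_ne_zero (by positivity) hv1 h1.symm
  refine ⟨σ, hσ, hD, ?_⟩
  rw [eq_div_iff hD]
  refine mul_right_cancel₀ (mul_pos hwn hvn).ne' ?_
  linear_combination t * h1 + h0 + ‖w‖ ^ 2 * h

/-- If the angle set is null, then from each point of the set only a null set of slopes is seen. -/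
theorem volume_slopes_eq_zero {E : Set (EuclideanSpace ℝ (Fin 2))}
    (hA : volume (angleSet E) = 0) {x : EuclideanSpace ℝ (Fin 2)} (hx : x ∈ E) :
    volume {t : ℝ | ∃ y ∈ E, y ≠ x ∧ (y - x) 0 + t * (y - x) 1 = 0} = 0 := by
  by_cases hz : ∃ z ∈ E, z ≠ x
  swap
  · push Not at hz
    convert measure_empty (μ := (volume : Measure ℝ)) using 2
    refine eq_empty_of_forall_notMem ?_
    rintro t ⟨y, hy, hyx, -⟩
    exact hyx (hz y hy)
  obtain ⟨z, hzE, hzx⟩ := hz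
  set w := z - x with hw
  have hw0 : w ≠ 0 := sub_ne_zero.2 hzx
  let D : ℝ → ℝ → ℝ := fun σ α => Real.cos α * w 1 + σ * Real.sin α * w 0
  let f : ℝ → ℝ → ℝ := fun σ α => -(Real.cos α * w 0 - σ * Real.sin α * w 1) / D σ α
  have hnull : ∀ σ, volume (f σ '' (angleSet E ∩ {α | D σ α ≠ 0})) = 0 := by
    intro σ
    refine addHaar_image_eq_zero_of_differentiableOn_of_addHaar_eq_zero volume ?_
      (measure_mono_null inter_subset_left hA)
    intro α hα
    refine DifferentiableAt.differentiableWithinAt ?_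
    have h1 : DifferentiableAt ℝ (D σ) α := by fun_prop
    have h2 : DifferentiableAt ℝ (fun α => -(Real.cos α * w 0 - σ * Real.sin α * w 1)) α := by
      fun_prop
    exact h2.div h1 hα.2
  have hsub : {t : ℝ | ∃ y ∈ E, y ≠ x ∧ (y - x) 0 + t * (y - x) 1 = 0} ⊆
      (f 1 '' (angleSet E ∩ {α | D 1 α ≠ 0}) ∪ f (-1) '' (angleSet E ∩ {α | D (-1) α ≠ 0}))
        ∪ {-w 0 / w 1} := by
    rintro t ⟨y, hyE, hyx, ht⟩
    by_cases hyz : y = z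
    · right
      subst hyz
      have h1 : w 1 ≠ 0 := by
        intro h1
        rw [← hw, h1, mul_zero, add_zero] at ht
        refine hw0 (PiLp.ext fun i => ?_)
        fin_cases i
        · exact ht
        · exact h1
      rw [mem_singleton_iff, eq_div_iff h1]
      linarith
    · left
      have hα : InnerProductGeometry.angle w (y - x) ∈ angleSet E :=
        ⟨x, hx, z, hzE, y, hyE, hzx.symm, hyx.symm, Ne.symm hyz, rfl⟩
      obtain ⟨σ, hσ, hD, hf⟩ := slope_eq_of_angle hw0 (sub_ne_zero.2 hyx) ht
      rcases hσ with rfl | rfl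
      · exact Or.inl ⟨_, ⟨hα, hD⟩, hf.symm⟩
      · exact Or.inr ⟨_, ⟨hα, hD⟩, hf.symm⟩
  exact measure_mono_null hsub
    (measure_union_null (measure_union_null (hnull 1) (hnull (-1))) (by simp))

/-- The point where the line through `x` with direction `(-t, 1)` meets the horizontal axis. -/
def shear (t : ℝ) (x : EuclideanSpace ℝ (Fin 2)) : ℝ := x 0 + t * x 1

theorem shear_sub_shear (t : ℝ) (x y : EuclideanSpace ℝ (Fin 2)) :
    shear t x - shear t y = (x - y) 0 + t * (x - y) 1 := by
  simp only [shear, PiLp.sub_apply]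
  ring

theorem continuous_shear {Y : Type*} [TopologicalSpace Y] {f : Y → ℝ}
    {g : Y → EuclideanSpace ℝ (Fin 2)} (hf : Continuous f) (hg : Continuous g) :
    Continuous fun y => shear (f y) (g y) := by
  unfold shear
  fun_prop

theorem abs_shear_le {t : ℝ} (ht : t ∈ Icc (-1 : ℝ) 1) (x : EuclideanSpace ℝ (Fin 2)) :
    |shear t x| ≤ 2 * ‖x‖ := by
  have h0 : |x 0| ≤ ‖x‖ := PiLp.norm_apply_le x 0
  have h1 : |x 1| ≤ ‖x‖ := PiLp.norm_apply_le x 1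
  have h2 : |t * x 1| ≤ |x 1| := by
    rw [abs_mul]
    exact mul_le_of_le_one_left (abs_nonneg _) (abs_le.2 ht)
  have := abs_add_le (x 0) (t * x 1)
  unfold shear
  linarith

/-- The pairs `(x, t)` for which some point of `E` far from `x` lies close to the line through `x`
of slope parameter `t`. -/
def farCollision (E : Set (EuclideanSpace ℝ (Fin 2))) (ε : ℝ) (n : ℕ) : Set (E × ℝ) :=
  {p | ∃ y : E, |shear p.2 p.1 - shear p.2 y| ≤ 2⁻¹ ^ n ∧ ε ≤ dist p.1 y}

theorem isClosed_farCollision {E : Set (EuclideanSpace ℝ (Fin 2))} [CompactSpace E] (ε : ℝ)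
    (n : ℕ) : IsClosed (farCollision E ε n) := by
  have hc : IsClosed {q : (E × ℝ) × E |
      |shear q.1.2 q.1.1 - shear q.1.2 q.2| ≤ 2⁻¹ ^ n ∧ ε ≤ dist q.1.1 q.2} := by
    have h1 : Continuous fun q : (E × ℝ) × E => shear q.1.2 q.1.1 :=
      continuous_shear continuous_fst.snd (continuous_subtype_val.comp continuous_fst.fst)
    have h2 : Continuous fun q : (E × ℝ) × E => shear q.1.2 q.2 :=
      continuous_shear continuous_fst.snd (continuous_subtype_val.comp continuous_snd)
    have h3 : Continuous fun q : (E × ℝ) × E => dist q.1.1 q.2 :=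
      continuous_fst.fst.dist continuous_snd
    exact (isClosed_le (h1.sub h2).abs continuous_const).inter (isClosed_le continuous_const h3)
  convert isClosedMap_fst_of_compactSpace _ hc using 1
  ext p
  simp [farCollision]

theorem antitone_farCollision (E : Set (EuclideanSpace ℝ (Fin 2))) (ε : ℝ) :
    Antitone (farCollision E ε) := by
  rintro m n hmn p ⟨y, hy, hε⟩
  exact ⟨y, hy.trans (pow_le_pow_of_le_one (by norm_num) (by norm_num) hmn), hε⟩

theorem exists_shear_eq_of_mem_iInter_farCollision {E : Set (EuclideanSpace ℝ (Fin 2))}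
    [CompactSpace E] {ε : ℝ} {p : E × ℝ} (hp : p ∈ ⋂ n, farCollision E ε n) :
    ∃ y : E, shear p.2 y = shear p.2 p.1 ∧ ε ≤ dist p.1 y := by
  let K : ℕ → Set E := fun n => {y | |shear p.2 p.1 - shear p.2 y| ≤ 2⁻¹ ^ n ∧ ε ≤ dist p.1 y}
  have hcl : ∀ n, IsClosed (K n) := fun n => by
    have h1 : Continuous fun y : E => shear p.2 y :=
      continuous_shear continuous_const continuous_subtype_val
    have h2 : Continuous fun y : E => dist p.1 y := continuous_const.dist continuous_id
    exact (isClosed_le (continuous_const.sub h1).abs continuous_const).inter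
      (isClosed_le continuous_const h2)
  obtain ⟨y, hy⟩ := IsCompact.nonempty_iInter_of_sequence_nonempty_isCompact_isClosed K
    (fun n y hy => ⟨hy.1.trans
      (pow_le_pow_of_le_one (by norm_num) (by norm_num) (Nat.le_succ n)), hy.2⟩)
    (fun n => mem_iInter.1 hp n) (hcl 0).isCompact hcl
  rw [mem_iInter] at hy
  refine ⟨y, ?_, (hy 0).2⟩
  have h : |shear p.2 p.1 - shear p.2 y| ≤ 0 :=
    ge_of_tendsto' (tendsto_pow_atTop_nhds_zero_of_lt_one (by norm_num) (by norm_num))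
      fun n => (hy n).1
  exact (sub_eq_zero.1 (abs_nonpos_iff.1 h)).symm

theorem ENNReal.le_sq_add_quarter (a : ℝ≥0∞) : a ≤ a ^ 2 + 4⁻¹ := by
  rcases eq_or_ne a ∞ with rfl | ha
  · simp
  lift a to NNReal using ha
  have : a ≤ a ^ 2 + 4⁻¹ := by
    rw [← NNReal.coe_le_coe]
    push_cast
    nlinarith [sq_nonneg ((a : ℝ) - 1 / 2)]
  have h := ENNReal.coe_le_coe.2 this
  rw [ENNReal.coe_add, ENNReal.coe_pow, ENNReal.coe_inv (by norm_num)] at h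
  exact h

/-- Integrating over slopes, few pairs of close points have close shears. -/
theorem lintegral_prod_close_pairs_le {E : Set (EuclideanSpace ℝ (Fin 2))}
    {μ : Measure E} [SFinite μ] {r : ℝ} {η : ℝ≥0∞} {M : ℝ≥0∞} (hM : μ univ ≤ M)
    (hη : ∀ x, ∫⁻ y in Metric.ball x r, (edist x y)⁻¹ ∂μ ≤ η) (n : ℕ) :
    ∫⁻ t in Icc (-1 : ℝ) 1,
      (μ.prod μ) {p | |shear t p.1 - shear t p.2| ≤ 2⁻¹ ^ n ∧ dist p.1 p.2 < r}
      ≤ ENNReal.ofReal (8 * 2⁻¹ ^ n) * (η * M) := by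
  set Q : Set (ℝ × (E × E)) :=
    {z | |shear z.1 z.2.1 - shear z.1 z.2.2| ≤ 2⁻¹ ^ n ∧ dist z.2.1 z.2.2 < r} with hQ
  have hQm : MeasurableSet Q := by
    have h1 : Continuous fun z : ℝ × (E × E) => shear z.1 z.2.1 :=
      continuous_shear continuous_fst (continuous_subtype_val.comp continuous_snd.fst)
    have h2 : Continuous fun z : ℝ × (E × E) => shear z.1 z.2.2 :=
      continuous_shear continuous_fst (continuous_subtype_val.comp continuous_snd.snd)
    have h3 : Continuous fun z : ℝ × (E × E) => dist z.2.1 z.2.2 :=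
      continuous_snd.fst.dist continuous_snd.snd
    exact (isClosed_le (h1.sub h2).abs continuous_const).measurableSet.inter
      (isOpen_lt h3 continuous_const).measurableSet
  have hker : ∀ p : E × E, (volume.restrict (Icc (-1 : ℝ) 1)) ((fun t => (t, p)) ⁻¹' Q)
      ≤ ENNReal.ofReal (8 * 2⁻¹ ^ n) *
        (Metric.ball p.1 r).indicator (fun y => (edist p.1 y)⁻¹) p.2 := by
    intro p
    by_cases h : p.2 ∈ Metric.ball p.1 r
    · rw [indicator_of_mem h, Subtype.edist_eq, edist_eq_enorm_sub]
      refine (measure_mono ?_).trans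
        (volume_setOf_abs_add_mul_le (p.1.1 - p.2.1) (δ := 2⁻¹ ^ n) (by positivity))
      rintro t ⟨ht, -⟩
      rw [shear_sub_shear] at ht
      exact ht
    · have : (fun t => (t, p)) ⁻¹' Q = ∅ := by
        refine eq_empty_of_forall_notMem fun t ht => h ?_
        rw [Metric.mem_ball, dist_comm]
        exact ht.2
      rw [this, measure_empty]
      exact bot_le
  calc ∫⁻ t in Icc (-1 : ℝ) 1, (μ.prod μ) (Prod.mk t ⁻¹' Q)
      = ((volume.restrict (Icc (-1 : ℝ) 1)).prod (μ.prod μ)) Q := (Measure.prod_apply hQm).symm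
    _ = ∫⁻ p, (volume.restrict (Icc (-1 : ℝ) 1)) ((fun t => (t, p)) ⁻¹' Q) ∂(μ.prod μ) :=
        Measure.prod_apply_symm hQm
    _ ≤ ∫⁻ x, ∫⁻ y, (volume.restrict (Icc (-1 : ℝ) 1)) ((fun t => (t, (x, y))) ⁻¹' Q) ∂μ ∂μ :=
        lintegral_prod_le _
    _ ≤ ∫⁻ x, ENNReal.ofReal (8 * 2⁻¹ ^ n) * η ∂μ := by
        refine lintegral_mono fun x => (lintegral_mono fun y => hker (x, y)).trans ?_
        rw [lintegral_const_mul' _ _ ENNReal.ofReal_ne_top]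
        dsimp only
        rw [lintegral_indicator Metric.isOpen_ball.measurableSet]
        exact mul_le_mul_right (hη x) _
    _ ≤ _ := by
        rw [lintegral_const, mul_assoc]
        gcongr

/-- A compact planar set carrying a Frostman measure of exponent larger than one has a point from
which it is seen in a set of slopes of positive measure. -/
theorem exists_volume_slopes_ne_zero {E : Set (EuclideanSpace ℝ (Fin 2))} (hE : IsCompact E)
    (μ : ProbabilityMeasure E) {C q : ℝ≥0∞} (hC : C ≠ ∞) (hq : 2 * q < 1)
    (hμ : ∀ x n, (μ : Measure E) (Metric.ball x (2⁻¹ ^ n)) ≤ C * q ^ n) :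
    ∃ x ∈ E, volume {t : ℝ | ∃ y ∈ E, y ≠ x ∧ (y - x) 0 + t * (y - x) 1 = 0} ≠ 0 := by
  by_contra! hnull
  have : CompactSpace E := isCompact_iff_compactSpace.1 hE
  set lam : Measure ℝ := volume.restrict (Icc (-1 : ℝ) 1) with hlam
  have hlam2 : lam univ = 2 := by
    rw [hlam, Measure.restrict_apply_univ, Real.volume_Icc]
    norm_num
  have : IsFiniteMeasure lam := ⟨by rw [hlam2]; simp⟩
  obtain ⟨R, hR⟩ : ∃ R : ℕ, ∀ t ∈ Icc (-1 : ℝ) 1, ∀ x : E, |shear t x| < R := by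
    obtain ⟨B, hB⟩ := hE.isBounded.exists_norm_le
    obtain ⟨R, hR⟩ := exists_nat_gt (2 * B)
    refine ⟨R, fun t ht x => ((abs_shear_le ht x.1).trans ?_).trans_lt hR⟩
    linarith [hB _ x.2]
  have hη : (0 : ℝ≥0∞) < (64 * ((R : ℝ≥0∞) + 1))⁻¹ := ENNReal.inv_pos.2
    (ENNReal.mul_ne_top (by simp) (by simp))
  obtain ⟨J, hJ⟩ := exists_setLIntegral_inv_edist_le hC hq hμ hη
  set ε : ℝ := 2⁻¹ ^ J with hε
  have hεpos : 0 < ε := by positivity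
  have hBm : ∀ n, MeasurableSet (farCollision E ε n) := fun n =>
    (isClosed_farCollision ε n).measurableSet
  have hzero : ((μ : Measure E).prod lam) (⋂ n, farCollision E ε n) = 0 := by
    rw [Measure.measure_prod_null (MeasurableSet.iInter hBm)]
    refine Eventually.of_forall fun x => ?_
    refine Measure.absolutelyContinuous_of_le Measure.restrict_le_self
      (measure_mono_null ?_ (hnull x x.2))
    intro t ht
    obtain ⟨y, hy, hd⟩ := exists_shear_eq_of_mem_iInter_farCollision ht
    refine ⟨y, y.2, fun h => ?_, by rw [← shear_sub_shear, hy, sub_self]⟩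
    have : y = x := Subtype.ext h
    rw [this, dist_self] at hd
    exact hεpos.not_ge hd
  obtain ⟨n, hn⟩ : ∃ n, ((μ : Measure E).prod lam) (farCollision E ε n) < 4⁻¹ := by
    have := tendsto_measure_iInter_atTop (μ := (μ : Measure E).prod lam)
      (fun n => (hBm n).nullMeasurableSet) (antitone_farCollision E ε) ⟨0, measure_ne_top _ _⟩
    rw [hzero] at this
    exact (this.eventually (gt_mem_nhds (by simp : (0 : ℝ≥0∞) < 4⁻¹))).exists
  let B : ℝ → Set E := fun t => (fun x => (x, t)) ⁻¹' farCollision E ε n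
  have hBt : ∀ t, MeasurableSet (B t) := fun t => measurable_prodMk_right (hBm n)
  have hgood : ∀ t ∈ Icc (-1 : ℝ) 1, (μ : Measure E) (B t)ᶜ ^ 2 ≤ (2 * R * 2 ^ n) *
      ((μ : Measure E).prod (μ : Measure E))
        {p | |shear t p.1 - shear t p.2| ≤ 2⁻¹ ^ n ∧ dist p.1 p.2 < ε} := by
    intro t ht
    refine (sq_measure_le_prod_setOf_abs_sub_le (f := fun x : E => shear t x)
      (continuous_shear continuous_const continuous_subtype_val).measurable
      (hR t ht) (hBt t).compl n).trans (mul_le_mul_right (measure_mono ?_) _)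
    rintro p ⟨hp, -, hpt⟩
    refine ⟨hpt, ?_⟩
    by_contra! hd
    exact hp ⟨p.2, hpt, hd⟩
  have hint : ∫⁻ t, (μ : Measure E) (B t)ᶜ ^ 2 ∂lam ≤ 4⁻¹ := by
    calc ∫⁻ t, (μ : Measure E) (B t)ᶜ ^ 2 ∂lam
        ≤ ∫⁻ t, (2 * R * 2 ^ n) * ((μ : Measure E).prod (μ : Measure E))
            {p | |shear t p.1 - shear t p.2| ≤ 2⁻¹ ^ n ∧ dist p.1 p.2 < ε} ∂lam :=
          setLIntegral_mono' measurableSet_Icc hgood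
      _ ≤ (2 * R * 2 ^ n) * (ENNReal.ofReal (8 * 2⁻¹ ^ n) * ((64 * ((R : ℝ≥0∞) + 1))⁻¹ * 1)) := by
          rw [lintegral_const_mul' _ _ (ENNReal.mul_ne_top (ENNReal.mul_ne_top (by simp)
            (by simp)) (by simp))]
          exact mul_le_mul_right (lintegral_prod_close_pairs_le prob_le_one hJ n) _
      _ = ENNReal.ofReal (2 * R * 2 ^ n * (8 * 2⁻¹ ^ n * ((64 * ((R : ℝ) + 1))⁻¹ * 1))) := by
          have h1 : (2 * R * 2 ^ n : ℝ≥0∞) = ENNReal.ofReal (2 * R * 2 ^ n) := by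
            exact_mod_cast (ENNReal.ofReal_natCast (2 * R * 2 ^ n)).symm
          have h2 : (64 * ((R : ℝ≥0∞) + 1))⁻¹ = ENNReal.ofReal (64 * ((R : ℝ) + 1))⁻¹ := by
            rw [ENNReal.ofReal_inv_of_pos (by positivity)]
            exact_mod_cast congrArg (·⁻¹) (ENNReal.ofReal_natCast (64 * (R + 1))).symm
          rw [h1, h2, mul_one, mul_one, ← ENNReal.ofReal_mul (by positivity),
            ← ENNReal.ofReal_mul (by positivity)]
      _ ≤ ENNReal.ofReal 4⁻¹ := by
          refine ENNReal.ofReal_le_ofReal ?_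
          have h2 : (2 : ℝ) ^ n * 2⁻¹ ^ n = 1 := by rw [← mul_pow]; norm_num
          have hR1 : (0 : ℝ) < R + 1 := by positivity
          calc (2 * R * 2 ^ n * (8 * 2⁻¹ ^ n * ((64 * ((R : ℝ) + 1))⁻¹ * 1)) : ℝ)
              = ((2 : ℝ) ^ n * 2⁻¹ ^ n) * (R / (R + 1)) / 4 := by field_simp; ring
            _ ≤ 1 * 1 / 4 := by
              rw [h2]
              gcongr
              exact (div_le_one hR1).2 (by linarith)
            _ = _ := by norm_num
      _ = 4⁻¹ := by rw [ENNReal.ofReal_inv_of_pos (by norm_num)]; simp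
  have hbad : ∫⁻ t, (μ : Measure E) (B t) ∂lam ≤ 4⁻¹ :=
    (Measure.prod_apply_symm (hBm n)).symm.trans_le hn.le
  have h2 : (2 : ℝ≥0∞) ≤ 4⁻¹ + (4⁻¹ + 4⁻¹ * 2) := by
    calc (2 : ℝ≥0∞) = ∫⁻ _, 1 ∂lam := by rw [lintegral_one, hlam2]
      _ ≤ ∫⁻ t, ((μ : Measure E) (B t) + ((μ : Measure E) (B t)ᶜ ^ 2 + 4⁻¹)) ∂lam := by
          refine lintegral_mono fun t => ?_
          rw [← prob_add_prob_compl (μ := (μ : Measure E)) (hBt t)]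
          gcongr
          exact ENNReal.le_sq_add_quarter _
      _ = ∫⁻ t, (μ : Measure E) (B t) ∂lam
          + (∫⁻ t, (μ : Measure E) (B t)ᶜ ^ 2 ∂lam + 4⁻¹ * 2) := by
          rw [lintegral_add_left (measurable_measure_prodMk_right (hBm n)),
            lintegral_add_right _ measurable_const, lintegral_const, hlam2]
      _ ≤ _ := by gcongr
  have h3 : (4⁻¹ + (4⁻¹ + 4⁻¹ * 2) : ℝ≥0∞) = 1 := by
    rw [← mul_one (4⁻¹ : ℝ≥0∞), mul_assoc, ← mul_add, ← mul_add]
    norm_num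
    exact ENNReal.inv_mul_cancel (by simp) (by simp)
  rw [h3] at h2
  norm_num at h2

theorem angle_set_positive_measure
    (E : Set (EuclideanSpace ℝ (Fin 2))) (hE : IsCompact E) (hdim : 1 < dimH E)
    (hline : ¬ ∃ p v : EuclideanSpace ℝ (Fin 2), E ⊆ {q | ∃ t : ℝ, q = p + t • v}) :
    0 < volume (angleSet E) := by
  obtain ⟨s, h1s, hs⟩ := ENNReal.lt_iff_exists_nnreal_btwn.1 hdim
  have h1s : (1 : ℝ) < s := by exact_mod_cast h1s
  obtain ⟨μ, C, hC, hμ⟩ := exists_frostman_measure hE s.2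
    (by rw [hausdorffMeasure_of_lt_dimH hs]; simp : μH[(s : ℝ)] E ≠ 0)
  have hq : 2 * (2⁻¹ : ℝ≥0∞) ^ (s : ℝ) < 1 := by
    calc 2 * (2⁻¹ : ℝ≥0∞) ^ (s : ℝ) < 2 * (2⁻¹ : ℝ≥0∞) ^ (1 : ℝ) :=
          ENNReal.mul_lt_mul_right (by simp) (by simp)
            (ENNReal.rpow_lt_rpow_of_exponent_gt (by simp) (by simp) h1s)
      _ = 1 := by rw [ENNReal.rpow_one]; exact ENNReal.mul_inv_cancel (by simp) (by simp)
  obtain ⟨x, hx, hvol⟩ := exists_volume_slopes_ne_zero hE μ hC hq hμ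
  exact pos_iff_ne_zero.2 fun h => hvol (volume_slopes_eq_zero h hx)
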